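/- Recursive differential transform of a composed sine: Let x : ℝ → ℝ be infinitely differentiable, let X be its differential transform, and let S and C be the differential transforms of the functions t ↦ sin(x(t)) and t ↦ cos(x(t)), respectively. Then for every k ≥ 1, k·S(k) = Σ_{m=1}^{k} m·X(m)·C(k−m). -/

import Mathlib

/-- The differential transform (DT) of a function `x : ℝ → ℝ`:
`X(k) = (1/k!) · (d^k x/dt^k)(0)`, the k-th Taylor coefficient of `x` at 0. -/
noncomputable def DT (x : ℝ → ℝ) (k : ℕ) : ℝ :=
  (1 / (k.factorial : ℝ)) * iteratedDeriv k x 0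

theorem DT_deriv (f : ℝ → ℝ) (k : ℕ) : DT (deriv f) k = ((k + 1 : ℕ) : ℝ) * DT f (k + 1) := by
  simp only [DT, iteratedDeriv_succ', Nat.factorial_succ, Nat.cast_mul]
  field_simp

/-- The differential transform of a product is the Cauchy product of the transforms. -/
theorem DT_mul {f g : ℝ → ℝ} {n : ℕ} (hf : ContDiffAt ℝ n f 0) (hg : ContDiffAt ℝ n g 0) :
    DT (fun t => f t * g t) n = ∑ i ∈ Finset.range (n + 1), DT f i * DT g (n - i) := by
  simp only [DT]
  rw [iteratedDeriv_fun_mul hf hg, Finset.mul_sum]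
  refine Finset.sum_congr rfl fun i hi => ?_
  rw [Nat.cast_choose ℝ (Finset.mem_range_succ_iff.mp hi)]
  field_simp

theorem sine_composition_recursion (x : ℝ → ℝ) (hx : ContDiff ℝ (⊤ : ℕ∞) x) :
    ∀ k : ℕ, 1 ≤ k →
      (k : ℝ) * DT (fun t => Real.sin (x t)) k =
        ∑ m ∈ Finset.Icc 1 k,
          (m : ℝ) * DT x m * DT (fun t => Real.cos (x t)) (k - m) := by
  intro k hk
  obtain ⟨n, rfl⟩ := Nat.exists_eq_add_of_le' hk
  have hderiv : deriv (fun t => Real.sin (x t)) = fun t => deriv x t * Real.cos (x t) := by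
    funext t
    rw [deriv_sin (hx.differentiable (by simp) t), mul_comm]
  have hx' : ContDiff ℝ n (deriv x) :=
    (contDiff_infty_iff_deriv.mp hx).2.of_le (mod_cast le_top)
  have hcos : ContDiff ℝ n fun t => Real.cos (x t) :=
    hx.cos.of_le (mod_cast le_top)
  rw [← DT_deriv, hderiv, DT_mul hx'.contDiffAt hcos.contDiffAt, Finset.range_eq_Ico,
    ← Finset.Ico_add_one_right_eq_Icc, ← Finset.sum_Ico_add' _ 0 (n + 1) 1]
  refine Finset.sum_congr rfl fun i _ => ?_
  rw [DT_deriv, Nat.add_sub_add_right]
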